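/- arXiv:1706.03478 — 2 statements merged into one kernel-verified Lean document; each statement's English description precedes it below -/
import Mathlib

section
/- Let n, d be positive integers with d dividing n, and let r, s be integers. If gcd(r, d) = 1, then Σ_{1 ≤ k ≤ n, gcd(k,n)=1, k ≡ r (mod d)} c_n(k − s) = (φ(n)/φ(d)) · Σ_{e ∣ n, gcd(e,s)=1, gcd(e,d) ∣ r − s} (e·μ(n/e)/φ(e)) · φ(gcd(e, d)); and if gcd(r, d) > 1 the left-hand sum equals 0. -/
open Finset ArithmeticFunction

/-- The Ramanujan sum `c_n(k) = ∑_{e ∣ gcd(k,n)} e · μ(n/e)`. -/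
def ramanujanSum (n : ℕ) (k : ℤ) : ℤ :=
  ∑ e ∈ (Int.gcd k (n : ℤ)).divisors, (e : ℤ) * moebius (n / e)

theorem Nat.totient_gcd_mul_totient_lcm (a b : ℕ) :
    (a.gcd b).totient * (a.lcm b).totient = a.totient * b.totient := by
  rcases Nat.eq_zero_or_pos a with rfl | ha
  · simp
  have hg : 0 < a.gcd b := Nat.gcd_pos_of_pos_left b ha
  have h := Nat.totient_gcd_mul_totient_mul (a.gcd b) (a.lcm b)
  rw [Nat.gcd_mul_lcm, Nat.gcd_eq_left ((Nat.gcd_dvd_left a b).trans (Nat.dvd_lcm_left a b)),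
    Nat.totient_gcd_mul_totient_mul] at h
  exact (Nat.eq_of_mul_eq_mul_right hg h).symm

/-- The units modulo `n` are equidistributed among the reduced residue classes modulo a
divisor `m` of `n`. -/
theorem card_coprime_modEq_mul_totient {n m : ℕ} (hn : 0 < n) (hm : m ∣ n) {x : ℤ}
    (hx : IsCoprime x (m : ℤ)) :
    #{k ∈ Icc 1 n | Nat.gcd k n = 1 ∧ (k : ℤ) ≡ x [ZMOD (m : ℤ)]} * m.totient = n.totient := by
  classical
  have : NeZero n := ⟨hn.ne'⟩
  have : NeZero m := ⟨(Nat.pos_of_dvd_of_pos hm hn).ne'⟩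
  have hfib : #{k ∈ Icc 1 n | Nat.gcd k n = 1 ∧ (k : ℤ) ≡ x [ZMOD (m : ℤ)]} =
      #{u : (ZMod n)ˣ | ZMod.unitsMap hm u = ZMod.unitOfIsCoprime x hx} := by
    refine Finset.card_bij (fun k hk => ZMod.unitOfCoprime k (mem_filter.1 hk).2.1) ?_ ?_ ?_
    · intro k hk
      rw [mem_filter] at hk
      simpa [Units.ext_iff, ZMod.unitsMap_val, ← ZMod.intCast_eq_intCast_iff, ZMod.cast_natCast hm]
        using hk.2.2
    · intro a ha b hb hab
      rw [mem_filter, mem_Icc] at ha hb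
      have h : (a : ZMod n) = b := by simpa [Units.ext_iff] using hab
      rw [ZMod.natCast_eq_natCast_iff, Nat.modEq_iff_dvd] at h
      have hba : (b : ℤ) - a = 0 := Int.eq_zero_of_abs_lt_dvd h (by rw [abs_lt]; omega)
      omega
    · intro u hu
      obtain ⟨k, hk, hku⟩ : ∃ k ∈ Icc 1 n, (k : ZMod n) = (u : ZMod n) := by
        have hlt := ZMod.val_lt (u : ZMod n)
        have hval := ZMod.natCast_zmod_val (u : ZMod n)
        rcases Nat.eq_zero_or_pos (u : ZMod n).val with h0 | h0
        · exact ⟨n, by simp; omega, by rw [← hval, h0]; simp⟩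
        · exact ⟨_, by simp only [mem_Icc]; omega, hval⟩
      have hcop : Nat.Coprime k n := by
        rw [← ZMod.isUnit_iff_coprime, hku]
        exact u.isUnit
      refine ⟨k, mem_filter.2 ⟨hk, hcop, ?_⟩, by simpa [Units.ext_iff] using hku⟩
      simpa [Units.ext_iff, ZMod.unitsMap_val, ← ZMod.intCast_eq_intCast_iff, ← hku,
        ZMod.cast_natCast hm] using hu
  have hsurj := ZMod.unitsMap_surjective hm
  rw [hfib, ← ZMod.card_units_eq_totient n, ← ZMod.card_units_eq_totient m, ← Finset.card_univ,
    ← Finset.card_univ, Finset.card_eq_sum_card_fiberwise (s := univ) (f := ZMod.unitsMap hm)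
      (t := univ) (by simp),
    Finset.sum_congr rfl fun b _ => MonoidHom.card_fiber_eq_of_mem_range (ZMod.unitsMap hm)
      (hsurj b) (hsurj (ZMod.unitOfIsCoprime x hx)), Finset.sum_const, smul_eq_mul, mul_comm]

theorem Int.exists_modEq_and_modEq {a b r s : ℤ} (h : (Int.gcd a b : ℤ) ∣ r - s) :
    ∃ x, x ≡ r [ZMOD a] ∧ x ≡ s [ZMOD b] := by
  obtain ⟨c, hc⟩ := h
  rw [Int.gcd_eq_gcd_ab] at hc
  refine ⟨r - a * (Int.gcdA a b * c), ?_, ?_⟩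
  · exact Int.modEq_iff_dvd.2 ⟨Int.gcdA a b * c, by ring⟩
  · exact Int.modEq_iff_dvd.2 ⟨-(Int.gcdB a b * c), by linear_combination -hc⟩

theorem Int.ModEq.isCoprime {a b m : ℤ} (h : a ≡ b [ZMOD m]) (hb : IsCoprime b m) :
    IsCoprime a m := by
  obtain ⟨c, hc⟩ := h.symm.dvd
  rw [eq_add_of_sub_eq' hc]
  exact hb.add_mul_left_left c

theorem ramanujanSum_eq_sum_divisors_filter {n : ℕ} (hn : 0 < n) (k : ℤ) :
    ramanujanSum n k = ∑ e ∈ n.divisors with ((e : ℕ) : ℤ) ∣ k, (e : ℤ) * moebius (n / e) := by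
  refine Finset.sum_congr ?_ fun _ _ => rfl
  ext e
  have h0 : Int.gcd k n ≠ 0 := by
    rw [Ne, Int.gcd_eq_zero_iff]
    omega
  simp only [Nat.mem_divisors, mem_filter, Int.dvd_gcd_iff, Int.natCast_dvd_natCast, ne_eq, h0,
    hn.ne', not_false_eq_true, and_true]
  exact and_comm

/-- The number of units modulo `n` in two residue classes with moduli dividing `n`. -/
theorem card_coprime_modEq_modEq {n d e : ℕ} (hn : 0 < n) (hd : d ∣ n) (he : e ∣ n) {r s : ℤ}
    (hr : Int.gcd r (d : ℤ) = 1) :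
    (#{k ∈ Icc 1 n | (Nat.gcd k n = 1 ∧ (k : ℤ) ≡ r [ZMOD (d : ℤ)]) ∧ (e : ℤ) ∣ (k : ℤ) - s} : ℚ) =
      if Int.gcd (e : ℤ) s = 1 ∧ ((Nat.gcd e d : ℤ) ∣ r - s) then
        (n.totient : ℚ) / d.totient * ((Nat.gcd e d).totient / e.totient) else 0 := by
  split_ifs with h
  · obtain ⟨hes, hdvd⟩ := h
    obtain ⟨x, hxr, hxs⟩ := Int.exists_modEq_and_modEq (a := d) (b := e) (r := r) (s := s)
      (by rwa [Int.gcd_natCast_natCast, Nat.gcd_comm])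
    have hxd : IsCoprime x (d : ℤ) := hxr.isCoprime (Int.isCoprime_iff_gcd_eq_one.2 hr)
    have hxe : IsCoprime x (e : ℤ) :=
      hxs.isCoprime (Int.isCoprime_iff_gcd_eq_one.2 (by rwa [Int.gcd_comm]))
    have hxl : IsCoprime x ((Nat.lcm e d : ℕ) : ℤ) := by
      refine (hxe.mul_right hxd).of_isCoprime_of_dvd_right ?_
      exact_mod_cast Nat.lcm_dvd_mul e d
    have hcard := card_coprime_modEq_mul_totient hn (Nat.lcm_dvd he hd) hxl
    have hset : {k ∈ Icc 1 n | (Nat.gcd k n = 1 ∧ (k : ℤ) ≡ r [ZMOD (d : ℤ)]) ∧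
          (e : ℤ) ∣ (k : ℤ) - s} =
        {k ∈ Icc 1 n | Nat.gcd k n = 1 ∧ (k : ℤ) ≡ x [ZMOD ((Nat.lcm e d : ℕ) : ℤ)]} := by
      refine Finset.filter_congr fun k _ => ?_
      have hl : ((Nat.lcm e d : ℕ) : ℤ) = (Int.lcm (e : ℤ) (d : ℤ) : ℤ) := by simp [Int.lcm]
      rw [hl, ← Int.modEq_and_modEq_iff_modEq_lcm, and_assoc, ← Int.modEq_iff_dvd,
        Int.modEq_comm (a := s)]
      refine and_congr_right fun _ => ⟨fun h => ⟨h.2.trans hxs.symm, h.1.trans hxr.symm⟩,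
        fun h => ⟨h.2.trans hxr, h.1.trans hxs⟩⟩
    rw [hset]
    have hmul := Nat.totient_gcd_mul_totient_lcm e d
    have hd0 : (d.totient : ℚ) ≠ 0 := by
      exact_mod_cast (Nat.totient_pos.2 (Nat.pos_of_dvd_of_pos hd hn)).ne'
    have he0 : (e.totient : ℚ) ≠ 0 := by
      exact_mod_cast (Nat.totient_pos.2 (Nat.pos_of_dvd_of_pos he hn)).ne'
    rw [← hcard, div_mul_div_comm, eq_div_iff (mul_ne_zero hd0 he0)]
    norm_cast
    rw [mul_comm d.totient, ← hmul]
    ring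
  · rw [Nat.cast_eq_zero, Finset.card_eq_zero, Finset.filter_eq_empty_iff]
    rintro k - ⟨⟨hkn, hkr⟩, hks⟩
    refine h ⟨?_, ?_⟩
    · have hs : s ≡ k [ZMOD (e : ℤ)] := Int.modEq_iff_dvd.2 hks
      rw [Int.gcd_comm, ← Int.isCoprime_iff_gcd_eq_one]
      refine hs.isCoprime (Nat.isCoprime_iff_coprime.2 ?_)
      exact Nat.Coprime.coprime_dvd_right he hkn
    · have h1 : ((Nat.gcd e d : ℕ) : ℤ) ∣ (k : ℤ) - s :=
        (Int.natCast_dvd_natCast.2 (Nat.gcd_dvd_left e d)).trans hks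
      have h2 : ((Nat.gcd e d : ℕ) : ℤ) ∣ r - (k : ℤ) :=
        (Int.natCast_dvd_natCast.2 (Nat.gcd_dvd_right e d)).trans hkr.dvd
      simpa using dvd_add h2 h1

/-- **Corollary (Menon-type identity for Ramanujan sums)**.
Let `n, d` be positive integers with `d ∣ n` and let `r, s` be integers.  If `gcd r d = 1`, then
`∑_{1 ≤ k ≤ n, (k,n)=1, k ≡ r (mod d)} c_n (k - s)
  = (φ n / φ d) · ∑_{e ∣ n, (e,s)=1, (e,d) ∣ r - s} (e·μ(n/e)/φ e) · φ (gcd e d)`,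
and if `gcd r d > 1` the sum equals `0`. -/
theorem menon_ramanujan_identity (n d : ℕ) (hn : 0 < n) (hd : d ∣ n) (r s : ℤ) :
    (Int.gcd r (d : ℤ) = 1 →
      (∑ k ∈ (Finset.Icc 1 n).filter
          (fun k => Nat.gcd k n = 1 ∧ (k : ℤ) ≡ r [ZMOD (d : ℤ)]),
        (ramanujanSum n ((k : ℤ) - s) : ℚ))
      = ((Nat.totient n : ℚ) / (Nat.totient d : ℚ)) *
        ∑ e ∈ n.divisors.filter
            (fun (e : ℕ) => Int.gcd (e : ℤ) s = 1 ∧ ((Nat.gcd e d : ℤ) ∣ r - s)),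
          ((e : ℚ) * (moebius (n / e) : ℚ) / (Nat.totient e : ℚ)) *
            (Nat.totient (Nat.gcd e d) : ℚ)) ∧
    (1 < Int.gcd r (d : ℤ) →
      (∑ k ∈ (Finset.Icc 1 n).filter
          (fun k => Nat.gcd k n = 1 ∧ (k : ℤ) ≡ r [ZMOD (d : ℤ)]),
        (ramanujanSum n ((k : ℤ) - s) : ℚ)) = 0) := by
  refine ⟨fun hr => ?_, fun hr => ?_⟩
  · simp only [ramanujanSum_eq_sum_divisors_filter hn, Int.cast_sum,
      Finset.sum_filter (s := n.divisors)]
    rw [Finset.sum_comm, Finset.mul_sum]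
    refine Finset.sum_congr rfl fun e he => ?_
    rw [← Int.cast_sum, ← Finset.sum_filter, Finset.sum_const, Finset.filter_filter,
      nsmul_eq_mul, Int.cast_mul, Int.cast_natCast,
      card_coprime_modEq_modEq hn hd (Nat.dvd_of_mem_divisors he) hr]
    split_ifs
    · push_cast
      ring
    · simp
  · rw [Finset.filter_eq_empty_iff.2, Finset.sum_empty]
    rintro k - ⟨hkn, hkr⟩
    have hkd : IsCoprime (k : ℤ) (d : ℤ) :=
      Nat.isCoprime_iff_coprime.2 (Nat.Coprime.coprime_dvd_right hd hkn)
    exact hr.ne' (Int.isCoprime_iff_gcd_eq_one.1 (hkr.symm.isCoprime hkd))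
end

section
/- Let χ be a Dirichlet character (mod n) with conductor d (so d ∣ n), let χ* be the primitive character (mod d) inducing χ, let f be an even function (mod n), and let s be an integer. Then Σ_{k=1}^{n} f(k − s) χ(k) = φ(n) · χ*(s) · Σ_{δ ∣ n/d, gcd(δ,s)=1} (μ∗f)(δd)/φ(δd). -/
open Finset ArithmeticFunction

theorem ZMod.sum_Icc_natCast {M : Type*} [AddCommMonoid M] (n : ℕ) [NeZero n] (g : ZMod n → M) :
    ∑ k ∈ Icc 1 n, g (k : ZMod n) = ∑ x : ZMod n, g x := by
  refine sum_nbij (fun k : ℕ ↦ (k : ZMod n)) (by simp) ?_ ?_ (fun _ _ ↦ rfl)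
  · intro a ha b hb hab
    simp only [coe_Icc, Set.mem_Icc] at ha hb
    have h := (ZMod.natCast_eq_natCast_iff a b n).1 hab
    rw [← Int.natCast_modEq_iff] at h
    obtain ⟨c, hc⟩ := h.dvd
    have hlt : |(n : ℤ) * c| < n := by rw [← hc, abs_lt]; omega
    have h0 := Int.eq_zero_of_abs_lt_dvd (Dvd.intro c rfl) hlt
    omega
  · intro x _
    by_cases hx : x = 0
    · exact ⟨n, by simpa using Nat.one_le_iff_ne_zero.2 (NeZero.ne n), by simp [hx]⟩
    · refine ⟨x.val, ?_, by simp⟩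
      simp only [coe_Icc, Set.mem_Icc]
      exact ⟨Nat.one_le_iff_ne_zero.2 ((ZMod.val_ne_zero x).2 hx), (ZMod.val_lt x).le⟩

theorem Nat.sum_divisors_sum_moebius_mul {R : Type*} [NonAssocRing R] (g : ℕ → R) {m : ℕ}
    (hm : 0 < m) :
    ∑ e ∈ m.divisors, ∑ a ∈ e.divisors, (moebius a : R) * g (e / a) = g m := by
  refine (sum_eq_iff_sum_mul_moebius_eq
    (f := fun e ↦ ∑ a ∈ e.divisors, (moebius a : R) * g (e / a)) (g := g)).2 (fun e _ ↦ ?_) m hm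
  exact Nat.sum_divisorsAntidiagonal (fun a b ↦ (moebius a : R) * g b)

theorem MonoidHom.sum_fiber {G H R : Type*} [Group G] [Group H] [Fintype G] [DecidableEq H]
    [NonAssocSemiring R] (π : G →* H) [Fintype π.ker] (ψ : G →* R) (g₀ : G) :
    ∑ g with π g = π g₀, ψ g = ψ g₀ * ∑ k : π.ker, ψ k := by
  rw [mul_sum]
  symm
  refine sum_bij (fun k _ ↦ g₀ * (k : G)) ?_ ?_ ?_ ?_
  · rintro ⟨k, hk⟩ -
    simpa using hk
  · intro a _ b _ h
    exact Subtype.ext (mul_left_cancel h)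
  · intro g hg
    exact ⟨⟨g₀⁻¹ * g, by simpa [MonoidHom.mem_ker, inv_mul_eq_one] using (mem_filter.1 hg).2.symm⟩, mem_univ _,
      by simp⟩
  · intro k _
    simp

theorem ZMod.card_ker_unitsMap_mul_totient {n e : ℕ} [NeZero n] (he : e ∣ n) :
    Nat.card (ZMod.unitsMap he).ker * e.totient = n.totient := by
  have : NeZero e := ⟨ne_zero_of_dvd_ne_zero (NeZero.ne n) he⟩
  have h := (ZMod.unitsMap he).ker.card_mul_index
  rw [Subgroup.index_ker, MonoidHom.range_eq_top.2 (ZMod.unitsMap_surjective he),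
    Subgroup.card_top] at h
  simpa [Nat.card_eq_fintype_card, ZMod.card_units_eq_totient] using h

namespace DirichletCharacter

theorem sum_ker_unitsMap {R : Type*} [CommRing R] [IsDomain R] {n e : ℕ} [NeZero n] (he : e ∣ n)
    (χ : DirichletCharacter R n) [Fintype (ZMod.unitsMap he).ker] :
    ∑ k : (ZMod.unitsMap he).ker, χ ((k : (ZMod n)ˣ) : ZMod n) =
      if χ.conductor ∣ e then (Nat.card (ZMod.unitsMap he).ker : R) else 0 := by
  classical
  have key := sum_hom_units
    (((χ : ZMod n →* R).comp (Units.coeHom (ZMod n))).comp (ZMod.unitsMap he).ker.subtype)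
  refine key.trans ?_
  rw [Nat.card_eq_fintype_card, Nat.cast_ite, Nat.cast_zero]
  refine if_congr ?_ rfl rfl
  rw [← mem_conductorSet_iff_conductor_dvd χ he, mem_conductorSet_iff,
    factorsThrough_iff_ker_unitsMap he]
  simp only [SetLike.le_def, MonoidHom.ext_iff, Subtype.forall]
  refine forall₂_congr fun u hu ↦ ?_
  rw [MonoidHom.mem_ker, Units.ext_iff]
  simp

theorem sum_filter_castHom_eq {R : Type*} [CommRing R] {n e : ℕ} [NeZero n] (he : e ∣ n)
    (χ : DirichletCharacter R n) (v : ZMod e) :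
    ∑ x with ZMod.castHom he (ZMod e) x = v, χ x =
      ∑ u : (ZMod n)ˣ with (ZMod.unitsMap he u : ZMod e) = v, χ u := by
  symm
  refine sum_of_injOn (fun u : (ZMod n)ˣ ↦ (u : ZMod n)) Units.val_injective.injOn ?_ ?_
    (fun _ _ ↦ rfl)
  · intro u hu
    exact mem_coe.2 (mem_filter.2 ⟨mem_univ _, (mem_filter.1 hu).2⟩)
  · intro x hx hx'
    refine χ.map_nonunit ?_
    rintro ⟨u, rfl⟩
    exact hx' ⟨u, mem_coe.2 (mem_filter.2 ⟨mem_univ _, (mem_filter.1 hx).2⟩), rfl⟩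

theorem sum_filter_castHom_eq_intCast {n d e : ℕ} [NeZero n] (hd : d ∣ n) (he : e ∣ n)
    (χ : DirichletCharacter ℂ n) (χ' : DirichletCharacter ℂ d)
    (hcond : χ.conductor = d) (hind : χ = changeLevel hd χ') (s : ℤ) :
    ∑ x with ZMod.castHom he (ZMod e) x = (s : ZMod e), χ x =
      if d ∣ e ∧ IsCoprime s e then (n.totient : ℂ) / e.totient * χ' (s : ZMod d) else 0 := by
  classical
  have : NeZero e := ⟨ne_zero_of_dvd_ne_zero (NeZero.ne n) he⟩
  rw [sum_filter_castHom_eq]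
  by_cases hs : IsCoprime s e
  · obtain ⟨u₀, hu₀⟩ := ZMod.unitsMap_surjective he (ZMod.unitOfIsCoprime s hs)
    have hs' : (s : ZMod e) = (ZMod.unitsMap he u₀ : ZMod e) := by
      rw [hu₀, ZMod.coe_unitOfIsCoprime]
    simp only [hs', Units.val_inj]
    refine ((ZMod.unitsMap he).sum_fiber
      ((χ : ZMod n →* ℂ).comp (Units.coeHom (ZMod n))) u₀).trans ?_
    simp only [MonoidHom.comp_apply, Units.coeHom_apply, MonoidHom.coe_coe]
    rw [sum_ker_unitsMap he χ, hcond]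
    by_cases hde : d ∣ e
    · rw [if_pos hde, if_pos ⟨hde, hs⟩]
      have hχ : χ (u₀ : ZMod n) = χ' (s : ZMod d) := by
        rw [hind, changeLevel_eq_cast_of_dvd _ hd]
        congr 1
        have h := congrArg (ZMod.castHom hde (ZMod d)) hs'
        rw [map_intCast, ZMod.unitsMap_def, Units.coe_map] at h
        rw [h, MonoidHom.coe_coe, ← RingHom.comp_apply, ZMod.castHom_comp, ZMod.castHom_apply]
      have hne : (e.totient : ℂ) ≠ 0 := by
        exact_mod_cast (Nat.totient_pos.2 (NeZero.pos e)).ne'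
      rw [hχ, ← ZMod.card_ker_unitsMap_mul_totient he]
      push_cast
      field_simp
    · rw [if_neg hde, if_neg (fun h ↦ hde h.1), mul_zero]
  · rw [if_neg (fun h ↦ hs h.2)]
    refine sum_eq_zero fun u hu ↦ absurd ?_ hs
    rw [isCoprime_comm, ← ZMod.coe_int_isUnit_iff_isCoprime, ← (mem_filter.1 hu).2]
    exact Units.isUnit _

end DirichletCharacter

/-- **Theorem (Menon-type identity with Dirichlet characters and even functions)**.
Let `χ` be a Dirichlet character (mod `n`) with conductor `d` (so `d ∣ n`), let `χ*` be the
primitive character (mod `d`) inducing `χ`, let `f` be an even function (mod `n`), and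
let `s` be an integer.  Then
`∑_{k=1}^{n} f (k - s) χ(k) = φ n · χ*(s) · ∑_{δ ∣ n/d, (δ,s)=1} (μ∗f)(δd)/φ(δd)`. -/
theorem menon_dirichlet_character_even (n d : ℕ) (hn : 0 < n) (hd : d ∣ n)
    (χ : DirichletCharacter ℂ n) (χstar : DirichletCharacter ℂ d)
    (hcond : χ.conductor = d) (hprim : χstar.IsPrimitive)
    (hind : χ = DirichletCharacter.changeLevel hd χstar)
    (f : ℤ → ℂ) (hf : ∀ k : ℤ, f ((Int.gcd k (n : ℤ) : ℕ) : ℤ) = f k) (s : ℤ) :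
    ∑ k ∈ Finset.Icc 1 n, f ((k : ℤ) - s) * χ (k : ZMod n)
      = (Nat.totient n : ℂ) * χstar ((s : ℤ) : ZMod d) *
        ∑ δ ∈ (n / d).divisors.filter (fun (δ : ℕ) => Int.gcd (δ : ℤ) s = 1),
          (∑ a ∈ (δ * d).divisors, (moebius a : ℂ) * f (((δ * d) / a : ℕ) : ℤ)) /
            (Nat.totient (δ * d) : ℂ) := by
  have : NeZero n := ⟨hn.ne'⟩
  have hd0 : 0 < d := Nat.pos_of_dvd_of_pos hd hn
  set F : ℕ → ℂ := fun e ↦ ∑ a ∈ e.divisors, (moebius a : ℂ) * f ((e / a : ℕ) : ℤ)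
  have hexp (k : ℕ) : f ((k : ℤ) - s) = ∑ e ∈ n.divisors, if (k : ZMod e) = s then F e else 0 := by
    rw [← hf, ← Nat.sum_divisors_sum_moebius_mul (fun m : ℕ ↦ f (m : ℤ))
      (Int.gcd_pos_of_ne_zero_right _ (by exact_mod_cast hn.ne')), ← sum_filter]
    refine sum_congr ?_ fun _ _ ↦ rfl
    ext e
    have h : (k : ZMod e) = s ↔ (e : ℤ) ∣ k - s := by
      rw [eq_comm, ← ZMod.intCast_eq_intCast_iff_dvd_sub, Int.cast_natCast]
    rw [mem_filter, h, Nat.mem_divisors, Nat.mem_divisors, Int.dvd_gcd_iff,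
      Int.natCast_dvd_natCast, Ne, Int.gcd_eq_zero_iff]
    grind
  have hinner : ∀ e ∈ n.divisors,
      ∑ k ∈ Icc 1 n, (if (k : ZMod e) = s then F e else 0) * χ (k : ZMod n) =
        if d ∣ e ∧ IsCoprime s e then
          (n.totient : ℂ) * χstar (s : ZMod d) * (F e / (e.totient : ℂ)) else 0 := by
    intro e he
    have he := Nat.dvd_of_mem_divisors he
    have h := ZMod.sum_Icc_natCast n
      (fun x ↦ (if ZMod.castHom he (ZMod e) x = s then F e else 0) * χ x)
    simp only [map_natCast] at h
    rw [h]
    simp only [ite_mul, zero_mul]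
    rw [← sum_filter, ← mul_sum,
      DirichletCharacter.sum_filter_castHom_eq_intCast hd he χ χstar hcond hind s]
    split_ifs <;> ring
  simp only [hexp, sum_mul]
  rw [sum_comm, sum_congr rfl hinner, mul_sum]
  by_cases hs : IsCoprime s d
  · rw [← sum_filter]
    symm
    refine sum_bij (fun δ _ ↦ δ * d) ?_ ?_ ?_ (fun _ _ ↦ rfl)
    · intro δ hδ
      rw [mem_filter, Nat.mem_divisors, ← Int.isCoprime_iff_gcd_eq_one] at hδ
      rw [mem_filter, Nat.mem_divisors, Nat.cast_mul]
      exact ⟨⟨mul_comm d δ ▸ Nat.mul_dvd_of_dvd_div hd hδ.1.1, hn.ne'⟩,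
        dvd_mul_left d δ, hδ.2.symm.mul_right hs⟩
    · intro a _ b _ h
      exact Nat.eq_of_mul_eq_mul_right hd0 h
    · intro e he
      rw [mem_filter, Nat.mem_divisors] at he
      obtain ⟨⟨hen, -⟩, ⟨δ, rfl⟩, hcop⟩ := he
      refine ⟨δ, ?_, mul_comm δ d⟩
      rw [mem_filter, Nat.mem_divisors, ← Int.isCoprime_iff_gcd_eq_one]
      push_cast at hcop
      exact ⟨⟨Nat.dvd_div_of_mul_dvd hen, (Nat.div_pos (Nat.le_of_dvd hn hd) hd0).ne'⟩,
        hcop.of_mul_right_right.symm⟩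
  · simp [(DirichletCharacter.apply_eq_zero_iff χstar s).2 hs]
end
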